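/- Let Γ be an infinite group with finite symmetric generating set and word metric, and let f be a control function. If Γ satisfies the isoperimetric inequality (I^f_∂), then there exists C > 0 such that every nonempty finite subset F ⊆ Γ satisfies #F ≤ C·f(rad F)·#∂F, where rad F = min{ r ≥ 0 : F ⊆ B(g,r) for some g ∈ Γ }. Equivalently, the isodiametric profile D_Γ(r) = sup{ #F/#∂F : F ⊆ Γ finite, rad F ≤ r } satisfies D_Γ ≤ C·f. -/

import Mathlib

/-- Word length of `γ` with respect to a generating set `S`. -/
noncomputable def wLen {Γ : Type*} [Group Γ] (S : Set Γ) (γ : Γ) : ℕ :=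
  sInf {n | ∃ l : List Γ, (∀ s ∈ l, s ∈ S) ∧ l.length = n ∧ l.prod = γ}

/-- The left-invariant word metric `d(x,y) = |x⁻¹y|`. -/
noncomputable def wDist {Γ : Type*} [Group Γ] (S : Set Γ) (x y : Γ) : ℕ :=
  wLen S (x⁻¹ * y)

/-- A control function: non-decreasing, nonnegative on `[0,∞)`, `f 0 = 1`, with
controlled behaviour under additive shifts and multiplicative rescalings. -/
structure IsControlFun (f : ℝ → ℝ) : Prop where
  nonneg : ∀ t : ℝ, 0 ≤ t → 0 ≤ f t
  mono : ∀ s t : ℝ, 0 ≤ s → s ≤ t → f s ≤ f t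
  one_at_zero : f 0 = 1
  shift : ∀ K > (0:ℝ), ∃ L > (0:ℝ), ∀ t > (0:ℝ), f (t + K) ≤ L * f t
  scale : ∀ K > (0:ℝ), ∃ L > (0:ℝ), ∀ t > (0:ℝ), f (K * t) ≤ L * f t

/-- The boundary `∂A` with respect to the word metric of `S`. -/
def isoBdryW {Γ : Type*} [Group Γ] (S : Set Γ) (A : Set Γ) : Set Γ :=
  {x | (∃ a ∈ A, wDist S x a ≤ 1) ∧ (∃ b ∈ Aᶜ, wDist S x b ≤ 1)}

/-- The isoperimetric inequality `(I^f_∂)` for the word metric of `S`. -/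
def SatIsoW {Γ : Type*} [Group Γ] (S : Set Γ) (f : ℝ → ℝ) : Prop :=
  ∃ C > (0:ℝ), ∀ A : Finset Γ,
    (A.card : ℝ) ≤ C * ∑ᶠ x ∈ isoBdryW S (A : Set Γ), f (wLen S x : ℝ)

/-- The radius of a finite set: the least `r` such that `A` is contained in a closed
ball of radius `r`. -/
noncomputable def radW {Γ : Type*} [Group Γ] (S : Set Γ) (A : Finset Γ) : ℕ :=
  sInf {r : ℕ | ∃ g : Γ, ∀ x ∈ A, wDist S g x ≤ r}

section WordMetric

variable {Γ : Type*} [Group Γ]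

theorem wLen_prod_le {S : Set Γ} {l : List Γ} (hl : ∀ s ∈ l, s ∈ S) :
    wLen S l.prod ≤ l.length :=
  Nat.sInf_le ⟨l, hl, rfl, rfl⟩

theorem exists_list_length_eq_wLen {S : Set Γ} (hsym : ∀ s ∈ S, s⁻¹ ∈ S)
    (hgen : Subgroup.closure S = ⊤) (γ : Γ) :
    ∃ l : List Γ, (∀ s ∈ l, s ∈ S) ∧ l.length = wLen S γ ∧ l.prod = γ := by
  have hne : {n | ∃ l : List Γ, (∀ s ∈ l, s ∈ S) ∧ l.length = n ∧ l.prod = γ}.Nonempty := by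
    have hγ : γ ∈ Subgroup.closure S := hgen ▸ Subgroup.mem_top γ
    rw [← Subgroup.mem_toSubmonoid, Subgroup.closure_toSubmonoid] at hγ
    obtain ⟨l, hl, hprod⟩ := Submonoid.exists_list_of_mem_closure hγ
    refine ⟨l.length, l, fun s hs => ?_, rfl, hprod⟩
    rcases hl s hs with h | h
    · exact h
    · simpa using hsym _ h
  exact Nat.sInf_mem hne

theorem wLen_mul_le {S : Set Γ} (hsym : ∀ s ∈ S, s⁻¹ ∈ S)
    (hgen : Subgroup.closure S = ⊤) (a b : Γ) :
    wLen S (a * b) ≤ wLen S a + wLen S b := by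
  obtain ⟨l, hl, hlen, hprod⟩ := exists_list_length_eq_wLen hsym hgen a
  obtain ⟨m, hm, hmlen, hmprod⟩ := exists_list_length_eq_wLen hsym hgen b
  have h : ∀ s ∈ l ++ m, s ∈ S := fun s hs =>
    (List.mem_append.1 hs).elim (hl s) (hm s)
  simpa [hlen, hprod, hmlen, hmprod] using wLen_prod_le h

theorem wLen_inv_le {S : Set Γ} (hsym : ∀ s ∈ S, s⁻¹ ∈ S)
    (hgen : Subgroup.closure S = ⊤) (a : Γ) : wLen S a⁻¹ ≤ wLen S a := by
  obtain ⟨l, hl, hlen, hprod⟩ := exists_list_length_eq_wLen hsym hgen a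
  have h : ∀ s ∈ (l.map (·⁻¹)).reverse, s ∈ S := by
    intro s hs
    obtain ⟨t, ht, rfl⟩ := List.mem_map.1 (List.mem_reverse.1 hs)
    exact hsym t (hl t ht)
  simpa [← List.prod_inv_reverse, hlen, hprod] using wLen_prod_le h

theorem eq_one_or_mem_of_wLen_le_one {S : Set Γ} (hsym : ∀ s ∈ S, s⁻¹ ∈ S)
    (hgen : Subgroup.closure S = ⊤) {γ : Γ} (h : wLen S γ ≤ 1) : γ = 1 ∨ γ ∈ S := by
  obtain ⟨l, hl, hlen, rfl⟩ := exists_list_length_eq_wLen hsym hgen γ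
  rw [← hlen] at h
  match l, hl, h with
  | [], _, _ => simp
  | [s], hl, _ => simpa using Or.inr (hl s (by simp))

theorem wDist_mul_left (S : Set Γ) (g x y : Γ) : wDist S (g * x) (g * y) = wDist S x y := by
  simp [wDist, mul_assoc]

theorem isoBdryW_finite {S : Set Γ} (hS : S.Finite) (hsym : ∀ s ∈ S, s⁻¹ ∈ S)
    (hgen : Subgroup.closure S = ⊤) {A : Set Γ} (hA : A.Finite) : (isoBdryW S A).Finite := by
  refine (Set.Finite.image2 (fun a s => a * s⁻¹) hA (hS.insert 1)).subset ?_
  rintro x ⟨⟨a, ha, hxa⟩, -⟩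
  exact ⟨a, ha, x⁻¹ * a, eq_one_or_mem_of_wLen_le_one hsym hgen hxa, by simp⟩

theorem isoBdryW_image_mul_left (S : Set Γ) (g : Γ) (A : Set Γ) :
    isoBdryW S ((g * ·) '' A) = (g * ·) '' isoBdryW S A := by
  ext x
  obtain ⟨x, rfl⟩ : ∃ y, g * y = x := ⟨g⁻¹ * x, by simp⟩
  rw [(mul_right_injective g).mem_set_image]
  refine and_congr (by simp only [Set.exists_mem_image, wDist_mul_left]) ⟨?_, ?_⟩
  · rintro ⟨b, hb, hxb⟩
    refine ⟨g⁻¹ * b, fun h => hb ⟨_, h, by simp⟩, ?_⟩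
    rw [← wDist_mul_left S g]
    simpa using hxb
  · rintro ⟨b, hb, hxb⟩
    refine ⟨g * b, fun h => hb ((mul_right_injective g).mem_set_image.1 h), ?_⟩
    rwa [wDist_mul_left]

theorem exists_center_radW (S : Set Γ) (A : Finset Γ) :
    ∃ g : Γ, ∀ x ∈ A, wDist S g x ≤ radW S A :=
  Nat.sInf_mem (s := {r : ℕ | ∃ g : Γ, ∀ x ∈ A, wDist S g x ≤ r})
    ⟨A.sup (wDist S 1), 1, fun _ hx => Finset.le_sup hx⟩

theorem wLen_le_of_mem_isoBdryW {S : Set Γ} (hsym : ∀ s ∈ S, s⁻¹ ∈ S)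
    (hgen : Subgroup.closure S = ⊤) {A : Set Γ} {r : ℕ} (hA : ∀ a ∈ A, wLen S a ≤ r)
    {x : Γ} (hx : x ∈ isoBdryW S A) : wLen S x ≤ r + 1 := by
  obtain ⟨⟨a, ha, hxa⟩, -⟩ := hx
  have h := wLen_mul_le hsym hgen a (x⁻¹ * a)⁻¹
  have h' : wLen S (x⁻¹ * a)⁻¹ ≤ 1 := (wLen_inv_le hsym hgen _).trans hxa
  rw [show a * (x⁻¹ * a)⁻¹ = x by group] at h
  exact h.trans (Nat.add_le_add (hA a ha) h')

end WordMetric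

/-- Unlike the field `IsControlFun.shift`, this includes `t = 0`. -/
theorem IsControlFun.exists_add_one_le {f : ℝ → ℝ} (hf : IsControlFun f) :
    ∃ L > (0 : ℝ), ∀ t : ℝ, 0 ≤ t → f (t + 1) ≤ L * f t := by
  obtain ⟨L, hL, h⟩ := hf.shift 1 one_pos
  refine ⟨max L (f 1), lt_max_of_lt_left hL, fun t ht => ?_⟩
  rcases ht.eq_or_lt with rfl | ht'
  · simp [hf.one_at_zero]
  · exact (h t ht').trans (mul_le_mul_of_nonneg_right (le_max_left _ _) (hf.nonneg t ht))

/-- If an infinite finitely generated group satisfies `(I^f_∂)`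
then its isodiametric profile is dominated by `f`:
`#F ≤ C · f(rad F) · #∂F` for every nonempty finite `F`. -/
theorem isodiametric_profile_bounded_by_control
    {Γ : Type*} [Group Γ] [Infinite Γ] (S : Finset Γ)
    (hsym : ∀ s ∈ S, s⁻¹ ∈ S)
    (hgen : Subgroup.closure (S : Set Γ) = ⊤)
    (f : ℝ → ℝ) (hf : IsControlFun f)
    (hiso : SatIsoW (S : Set Γ) f) :
    ∃ C > (0:ℝ), ∀ A : Finset Γ, A.Nonempty →
      (A.card : ℝ) ≤
        C * f ((radW (S : Set Γ) A : ℝ)) *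
          ((isoBdryW (S : Set Γ) (A : Set Γ)).ncard : ℝ) := by
  classical
  obtain ⟨C, hC, hiso⟩ := hiso
  obtain ⟨L, hL, hshift⟩ := hf.exists_add_one_le
  have hsym' : ∀ s ∈ (S : Set Γ), s⁻¹ ∈ (S : Set Γ) := hsym
  refine ⟨C * L, mul_pos hC hL, fun A _ => ?_⟩
  obtain ⟨g, hg⟩ := exists_center_radW (S : Set Γ) A
  set r := radW (S : Set Γ) A
  have hfin := isoBdryW_finite S.finite_toSet hsym' hgen A.finite_toSet
  have hinj := mul_right_injective g⁻¹
  have hA := hiso (A.image (g⁻¹ * ·))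
  rw [Finset.card_image_of_injective A hinj, Finset.coe_image] at hA
  have hbdry := isoBdryW_image_mul_left (S : Set Γ) g⁻¹ (A : Set Γ)
  have hfin' : (isoBdryW (S : Set Γ) ((g⁻¹ * ·) '' (A : Set Γ))).Finite :=
    hbdry ▸ hfin.image _
  have hcard : hfin'.toFinset.card = (isoBdryW (S : Set Γ) (A : Set Γ)).ncard := by
    rw [← Set.ncard_eq_toFinset_card _ hfin', hbdry, Set.ncard_image_of_injective _ hinj]
  have hbound : ∀ x ∈ hfin'.toFinset, f (wLen (S : Set Γ) x : ℝ) ≤ L * f r := by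
    intro x hx
    have hlen : wLen (S : Set Γ) x ≤ r + 1 := by
      refine wLen_le_of_mem_isoBdryW hsym' hgen ?_ (hfin'.mem_toFinset.1 hx)
      rintro _ ⟨a, ha, rfl⟩
      exact hg a ha
    exact (hf.mono _ _ (Nat.cast_nonneg _) (by exact_mod_cast hlen)).trans
      (hshift r (Nat.cast_nonneg _))
  have hsum := Finset.sum_le_card_nsmul _ _ _ hbound
  rw [finsum_mem_eq_finite_toFinset_sum _ hfin'] at hA
  rw [hcard, nsmul_eq_mul] at hsum
  calc (A.card : ℝ) ≤ _ := hA
    _ ≤ C * (_ * (L * f r)) := mul_le_mul_of_nonneg_left hsum hC.le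
    _ = _ := by ring
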